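/- If M is Cohen–Macaulay with respect to Q, i.e. grade(Q, M) = cd(Q, M), then grade(Q, M) = cd(Q, S/p) for every associated prime p of M; in particular, M has maximal depth with respect to Q. -/

import Mathlib

open CategoryTheory MvPolynomial

noncomputable section

/-- The standard bigraded polynomial ring `S = K[x_1,…,x_m, y_1,…,y_n]`. -/
abbrev BGS (K : Type) [Field K] (m n : ℕ) : Type := MvPolynomial (Fin m ⊕ Fin n) K

/-- The bigrading weights: `deg x_i = (1,0)`, `deg y_j = (0,1)`. -/
def bwt (m n : ℕ) : Fin m ⊕ Fin n → ℕ × ℕ := Sum.elim (fun _ => (1, 0)) (fun _ => (0, 1))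

/-- `P = (x_1, …, x_m)`. -/
def idealP (K : Type) [Field K] (m n : ℕ) : Ideal (BGS K m n) :=
  Ideal.span (Set.range fun i : Fin m => (X (Sum.inl i) : BGS K m n))

/-- `Q = (y_1, …, y_n)`. -/
def idealQ (K : Type) [Field K] (m n : ℕ) : Ideal (BGS K m n) :=
  Ideal.span (Set.range fun j : Fin n => (X (Sum.inr j) : BGS K m n))

/-- `cd(J, M)`: the cohomological dimension, i.e. the largest `i` such that the local
cohomology module `H^i_J(M)` is nonzero. -/
def cohDim (R : Type) [CommRing R] (J : Ideal R) (M : Type) [AddCommGroup M] [Module R M] : ℕ :=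
  sSup {i : ℕ | Nontrivial ((localCohomology J i).obj (ModuleCat.of R M))}

/-- `grade(J, M)`: the least `i` with `Ext^i(R/J, M) ≠ 0`. -/
def extGrade (R : Type) [CommRing R] (J : Ideal R) (M : Type) [AddCommGroup M] [Module R M] : ℕ :=
  sInf {i : ℕ | Nontrivial
    (((Ext R (ModuleCat R) i).obj (Opposite.op (ModuleCat.of R (R ⧸ J)))).obj (ModuleCat.of R M))}

/-- `mgrade(J, M) = min {cd(J, R/p) : p ∈ Ass(M)}`. -/
def mCohDim (R : Type) [CommRing R] (J : Ideal R) (M : Type) [AddCommGroup M] [Module R M] : ℕ :=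
  sInf ((fun p => cohDim R J (R ⧸ p)) '' associatedPrimes R M)

/-- `M` has maximal depth with respect to `J` if `grade(J, M) = mgrade(J, M)`. -/
def HasMaximalDepth (R : Type) [CommRing R] (J : Ideal R) (M : Type) [AddCommGroup M]
    [Module R M] : Prop :=
  extGrade R J M = mCohDim R J M

/-- A bigrading on an `S`-module `M`: an internal direct sum decomposition indexed by `ℕ × ℕ`
compatible with the bigrading of `S`. -/
structure IsBigrading (K : Type) [Field K] (m n : ℕ) (M : Type) [AddCommGroup M]
    [Module (BGS K m n) M] (ℳ : ℕ × ℕ → AddSubgroup M) : Prop where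
  internal : DirectSum.IsInternal ℳ
  smul_mem : ∀ (d e : ℕ × ℕ) (s : BGS K m n) (x : M),
    IsWeightedHomogeneous (bwt m n) s d → x ∈ ℳ e → s • x ∈ ℳ (d + e)

/-- A submodule is bigraded if it is generated by bihomogeneous elements. -/
def IsBigradedSubmodule (K : Type) [Field K] (m n : ℕ) {M : Type} [AddCommGroup M]
    [Module (BGS K m n) M] (ℳ : ℕ × ℕ → AddSubgroup M) (N : Submodule (BGS K m n) M) : Prop :=
  N = Submodule.span (BGS K m n) {x : M | x ∈ N ∧ ∃ d, x ∈ ℳ d}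

section Bridge
open Opposite

variable {R : Type} [CommRing R]

/-- The complex computing the old `Ext`. -/
abbrev oldK {X : ModuleCat.{0} R} (P : ProjectiveResolution X) (Y : ModuleCat.{0} R) :
    ChainComplex (ModuleCat.{0} R)ᵒᵖ ℕ :=
  (((linearYoneda R (ModuleCat.{0} R)).obj Y).rightOp.mapHomologicalComplex _).obj P.complex

abbrev oldExt (X Y : ModuleCat.{0} R) (n : ℕ) : ModuleCat R :=
  ((Ext R (ModuleCat.{0} R) n).obj (op X)).obj Y

def oldIso {X : ModuleCat.{0} R} (P : ProjectiveResolution X) (Y : ModuleCat.{0} R) (n : ℕ) :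
    (((linearYoneda R (ModuleCat.{0} R)).obj Y).rightOp.leftDerived n).obj X ≅
      (oldK P Y).homology n :=
  P.isoLeftDerivedObj ((linearYoneda R (ModuleCat.{0} R)).obj Y).rightOp n

def oldJ {X : ModuleCat.{0} R} (P : ProjectiveResolution X) (Y : ModuleCat.{0} R) (n : ℕ) :
    ((oldK P Y).homology n).unop ⟶ oldExt X Y n := (oldIso P Y n).hom.unop

lemma oldJ_iso {X : ModuleCat.{0} R} (P : ProjectiveResolution X) (Y : ModuleCat.{0} R) (n : ℕ) :
    IsIso (oldJ P Y n) :=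
  (inferInstance : IsIso (oldIso P Y n).hom.unop)

lemma oldJ_inj {X : ModuleCat.{0} R} (P : ProjectiveResolution X) (Y : ModuleCat.{0} R) (n : ℕ) :
    Function.Injective (oldJ P Y n) := by
  have := oldJ_iso P Y n
  exact (ModuleCat.mono_iff_injective _).1 inferInstance

/-- The class map -/
def oldCls {X : ModuleCat.{0} R} (P : ProjectiveResolution X) (Y : ModuleCat.{0} R) (n : ℕ) :
    ((oldK P Y).opcycles n).unop ⟶ oldExt X Y n :=
  ((oldK P Y).homologyι n).unop ≫ oldJ P Y n

def oldInc {X : ModuleCat.{0} R} (P : ProjectiveResolution X) (Y : ModuleCat.{0} R) (n : ℕ) :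
    ((oldK P Y).opcycles n).unop ⟶ ModuleCat.of R (P.complex.X n ⟶ Y) :=
  ((oldK P Y).pOpcycles n).unop

lemma oldCls_surj {X : ModuleCat.{0} R} (P : ProjectiveResolution X) (Y : ModuleCat.{0} R) (n : ℕ) :
    Function.Surjective (oldCls P Y n) := by
  have : Epi (oldCls P Y n) := by
    have h1 := oldJ_iso P Y n
    have h2 : Epi ((oldK P Y).homologyι n).unop := unop_epi_of_mono _
    exact epi_comp _ _
  exact (ModuleCat.epi_iff_surjective _).1 this

lemma oldInc_inj {X : ModuleCat.{0} R} (P : ProjectiveResolution X) (Y : ModuleCat.{0} R) (n : ℕ) :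
    Function.Injective (oldInc P Y n) := by
  have : Mono (oldInc P Y n) := by
    exact unop_mono_of_epi ((oldK P Y).pOpcycles n)
  exact (ModuleCat.mono_iff_injective _).1 this

lemma oldInc_d {X : ModuleCat.{0} R} (P : ProjectiveResolution X) (Y : ModuleCat.{0} R) (n : ℕ)
    (z : ((oldK P Y).opcycles n).unop) :
    P.complex.d (n+1) n ≫ (oldInc P Y n z : P.complex.X n ⟶ Y) = 0 := by
  have h := (oldK P Y).d_pOpcycles (n+1) n
  have h2 := congrArg Quiver.Hom.unop h
  exact congr($h2 z)

lemma oldInc_ex {X : ModuleCat.{0} R} (P : ProjectiveResolution X) (Y : ModuleCat.{0} R) (n : ℕ)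
    (f : P.complex.X n ⟶ Y) (hf : P.complex.d (n+1) n ≫ f = 0) :
    ∃ z, oldInc P Y n z = f := by
  have h := ((ShortComplex.mk _ _ ((oldK P Y).d_pOpcycles (n+1) n)).exact_of_g_is_cokernel
    ((oldK P Y).opcyclesIsCokernel (n+1) n (by simp))).unop
  rw [ShortComplex.moduleCat_exact_iff] at h
  exact h f hf

lemma oldCls_zero_succ {X : ModuleCat.{0} R} (P : ProjectiveResolution X) (Y : ModuleCat.{0} R)
    (n : ℕ) (z : ((oldK P Y).opcycles (n+1)).unop) :
    oldCls P Y (n+1) z = 0 ↔ ∃ g : P.complex.X n ⟶ Y, P.complex.d (n+1) n ≫ g =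
      (oldInc P Y (n+1) z : P.complex.X (n+1) ⟶ Y) := by
  have hc : oldCls P Y (n+1) z = 0 ↔ ((oldK P Y).homologyι (n+1)).unop z = 0 := by
    unfold oldCls
    constructor
    · intro h
      apply oldJ_inj
      rw [map_zero]
      exact h
    · intro h
      rw [ModuleCat.comp_apply, h, map_zero]
  have h := ((ShortComplex.mk _ _ ((oldK P Y).homologyι_comp_fromOpcycles (n+1) n)).exact_of_f_is_kernel
    ((oldK P Y).homologyIsKernel (n+1) n (by simp))).unop
  rw [ShortComplex.moduleCat_exact_iff] at h
  have hp := congrArg Quiver.Hom.unop ((oldK P Y).p_fromOpcycles (n+1) n)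
  rw [hc]
  constructor
  · intro hz
    obtain ⟨g, hg⟩ := h z hz
    refine ⟨g, ?_⟩
    rw [← hg]
    exact congr($hp g).symm
  · rintro ⟨g, hg⟩
    have : z = ((oldK P Y).fromOpcycles (n+1) n).unop g := by
      apply oldInc_inj
      rw [← hg]
      exact congr($hp g).symm
    rw [this]
    have := congrArg Quiver.Hom.unop ((oldK P Y).homologyι_comp_fromOpcycles (n+1) n)
    exact congr($this g)

lemma oldCls_zero_zero {X : ModuleCat.{0} R} (P : ProjectiveResolution X) (Y : ModuleCat.{0} R)
    (z : ((oldK P Y).opcycles 0).unop) :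
    oldCls P Y 0 z = 0 ↔ oldInc P Y 0 z = 0 := by
  have : IsIso ((oldK P Y).homologyι 0) := 
    (oldK P Y).isIso_homologyι 0 0 (by simp) (by simp)
  have hm : Mono (oldCls P Y 0) := by
    have h1 := oldJ_iso P Y 0
    have h2 : Mono ((oldK P Y).homologyι 0).unop := unop_mono_of_epi _
    exact mono_comp _ _
  have hi := (ModuleCat.mono_iff_injective _).1 hm
  constructor
  · intro h
    have : z = 0 := hi (by rw [h, map_zero])
    rw [this, map_zero]
  · intro h
    have : z = 0 := oldInc_inj _ _ _ (by rw [h, map_zero])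
    rw [this, map_zero]

lemma extMk_zero_deg {X Y : ModuleCat.{0} R} (P : ProjectiveResolution X)
    (f : P.complex.X 0 ⟶ Y) (hf : P.complex.d 1 0 ≫ f = 0) :
    P.extMk f 1 rfl hf = 0 ↔ f = 0 := by
  constructor
  · intro h
    rw [← P.extEquivCohomologyClass.apply_eq_iff_eq,
      ProjectiveResolution.extEquivCohomologyClass_extMk,
      ProjectiveResolution.extEquivCohomologyClass_zero,
      CochainComplex.HomComplex.CohomologyClass.mk_eq_zero_iff] at h
    rw [CochainComplex.HomComplex.Cocycle.toSingleMk_mem_coboundaries_iff _ _ _ _ _ 1 (by lia)] at h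
    obtain ⟨g, hg⟩ := h
    have h0 : Limits.IsZero (P.cochainComplex.X 1) := 
      P.cochainComplex.isZero_of_isStrictlyLE 0 1 (by lia)
    rw [h0.eq_of_src g 0, Limits.comp_zero] at hg
    rw [← cancel_epi (P.cochainComplexXIso (-(0:ℕ)) 0 rfl).hom, ← hg, Limits.comp_zero]
  · rintro rfl
    simp

def ExtRel {X Y : ModuleCat.{0} R} {n : ℕ} (x : oldExt X Y n) (α : Abelian.Ext X Y n) : Prop :=
  ∃ z : ((oldK (projectiveResolution X) Y).opcycles n).unop,
    oldCls (projectiveResolution X) Y n z = x ∧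
    (projectiveResolution X).extMk (oldInc (projectiveResolution X) Y n z) (n+1) rfl
      (oldInc_d _ _ _ _) = α

lemma ExtRel.left {X Y : ModuleCat.{0} R} {n : ℕ} (x : oldExt X Y n) :
    ∃ α : Abelian.Ext X Y n, ExtRel x α := by
  obtain ⟨z, hz⟩ := oldCls_surj (projectiveResolution X) Y n x
  exact ⟨_, z, hz, rfl⟩

lemma ExtRel.right {X Y : ModuleCat.{0} R} {n : ℕ} (α : Abelian.Ext X Y n) :
    ∃ x : oldExt X Y n, ExtRel x α := by
  obtain ⟨f, hf, rfl⟩ := (projectiveResolution X).extMk_surjective α (n+1) rfl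
  obtain ⟨z, rfl⟩ := oldInc_ex _ _ _ f hf
  exact ⟨_, z, rfl, rfl⟩

lemma ExtRel.zero_iff {X Y : ModuleCat.{0} R} {n : ℕ} {x : oldExt X Y n} {α : Abelian.Ext X Y n}
    (h : ExtRel x α) : x = 0 ↔ α = 0 := by
  obtain ⟨z, rfl, rfl⟩ := h
  cases n with
  | zero => rw [oldCls_zero_zero, extMk_zero_deg]
  | succ n => rw [oldCls_zero_succ, ProjectiveResolution.extMk_eq_zero_iff _ _ _ _ _ n rfl]

lemma ExtRel.map {X X' Y : ModuleCat.{0} R} {n : ℕ} {x : oldExt X Y n} {α : Abelian.Ext X Y n}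
    (h : ExtRel x α) (g : X' ⟶ X) :
    ExtRel (X := X') ((((Ext R (ModuleCat.{0} R) n).map g.op).app Y) x)
      ((Abelian.Ext.mk₀ g).comp α (zero_add n)) := by
  obtain ⟨z, rfl, rfl⟩ := h
  let P := projectiveResolution X
  let P' := projectiveResolution X'
  let φ : ProjectiveResolution.Hom P' P g :=
    { hom := ProjectiveResolution.lift g P' P
      hom_f_zero_comp_π_f_zero := by
        have := ProjectiveResolution.lift_commutes g P' P
        exact congr(($this).f 0) }
  let F := ((linearYoneda R (ModuleCat.{0} R)).obj Y).rightOp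
  let ψ : oldK P' Y ⟶ oldK P Y := (F.mapHomologicalComplex _).map φ.hom
  refine ⟨(HomologicalComplex.opcyclesMap ψ n).unop z, ?_, ?_⟩
  · have h1 : (F.leftDerived n).map g ≫ (oldIso P Y n).hom = (oldIso P' Y n).hom ≫
      HomologicalComplex.homologyMap ψ n := ProjectiveResolution.isoLeftDerivedObj_hom_naturality g P' P φ.hom
      φ.hom_f_zero_comp_π_f_zero F n
    have h2 := HomologicalComplex.homologyι_naturality ψ n
    have h4 : (oldIso P' Y n).hom ≫ (oldK P' Y).homologyι n ≫
      HomologicalComplex.opcyclesMap ψ n = 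
      (F.leftDerived n).map g ≫ (oldIso P Y n).hom ≫ (oldK P Y).homologyι n := by
      rw [← Category.assoc ((F.leftDerived n).map g), h1, ← h2, Category.assoc]
    have h5 := congrArg Quiver.Hom.unop h4
    exact congr($h5 z)
  · rw [ProjectiveResolution.mk₀_comp_extMk _ _ _ _ φ]
    congr 1
    have h2 := congrArg Quiver.Hom.unop (HomologicalComplex.p_opcyclesMap ψ n)
    exact congr($h2 z)

lemma oldExt_subsingleton_iff {X Y : ModuleCat.{0} R} {n : ℕ} :
    Subsingleton (oldExt X Y n) ↔ Subsingleton (Abelian.Ext X Y n) := by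
  constructor
  · intro h
    refine subsingleton_of_forall_eq 0 fun α => ?_
    obtain ⟨x, hx⟩ := ExtRel.right α
    exact hx.zero_iff.1 (Subsingleton.elim _ _)
  · intro h
    refine subsingleton_of_forall_eq 0 fun α => ?_
    obtain ⟨x, hx⟩ := ExtRel.left α
    exact hx.zero_iff.2 (Subsingleton.elim _ _)

end Bridge

section VanDef
open Opposite Limits

variable {R : Type} [CommRing R]

def rmap {I I' : Ideal R} (h : I ≤ I') : ModuleCat.of R (R ⧸ I) ⟶ ModuleCat.of R (R ⧸ I') :=
  ModuleCat.ofHom (Submodule.mapQ I I' LinearMap.id h)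

/-- vanishing of local cohomology expressed by elements. -/
def Van (J : Ideal R) (j : ℕ) (N : ModuleCat.{0} R) : Prop :=
  ∀ (t : ℕ) (α : Abelian.Ext (ModuleCat.of R (R ⧸ J ^ t)) N j),
    ∃ t', ∃ h : t ≤ t', (Abelian.Ext.mk₀ (rmap (Ideal.pow_le_pow_right h : J ^ t' ≤ J ^ t))).comp α
      (zero_add j) = 0

lemma van_iff (J : Ideal R) (j : ℕ) (N : ModuleCat.{0} R) :
    Van J j N ↔ Subsingleton ((localCohomology J j).obj N) := by
  let D := localCohomology.diagram (localCohomology.idealPowersDiagram J) j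
  have hD : HasColimit D := localCohomology.hasColimitDiagram.{0,0} _ _
  let E := D ⋙ (evaluation _ _).obj N
  let c : Cocone E := ((evaluation _ _).obj N).mapCocone (colimit.cocone D)
  have hc : IsColimit c := isColimitOfPreserves ((evaluation _ _).obj N) (colimit.isColimit D)
  have key : Subsingleton c.pt ↔ Subsingleton ((localCohomology J j).obj N) := Iff.rfl
  rw [← key]
  constructor
  · intro hV
    refine subsingleton_of_forall_eq (0 : c.pt) fun x => ?_
    obtain ⟨t, y, rfl⟩ := Concrete.isColimit_exists_rep E hc x
    obtain ⟨α, hα⟩ := ExtRel.left (X := ModuleCat.of R (R ⧸ J ^ t.unop.unop)) (Y := N) (n := j) y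
    obtain ⟨t', h, h0⟩ := hV t.unop.unop α
    let u : t ⟶ op (op t') := (homOfLE h).op.op
    have h1 := (hα.map (rmap (Ideal.pow_le_pow_right h : J ^ t' ≤ J ^ t.unop.unop))).zero_iff.2 h0
    have h2 : (E.map u) y = 0 := h1
    have h3 := congr($(c.w u) y)
    rw [← h3]
    change (c.ι.app _) ((E.map u) y) = 0
    rw [h2, map_zero]
  · intro hs t α
    obtain ⟨y, hy⟩ := ExtRel.right α
    let y' : E.obj (op (op t)) := y
    have h0 : c.ι.app (op (op t)) y' = c.ι.app (op (op t)) 0 := hs.elim _ _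
    obtain ⟨k, f, g, hfg⟩ := Concrete.isColimit_exists_of_rep_eq E hc _ _ h0
    rw [map_zero] at hfg
    refine ⟨k.unop.unop, leOfHom f.unop.unop, ?_⟩
    apply (hy.map _).zero_iff.1
    exact hfg

end VanDef

section Tors
variable {R : Type} [CommRing R] (J : Ideal R)

/-- `J`-power torsion submodule. -/
def gam (N : Type) [AddCommGroup N] [Module R N] : Submodule R N where
  carrier := {x | ∃ t, ∀ a ∈ J ^ t, a • x = 0}
  add_mem' := by
    rintro x y ⟨s, hs⟩ ⟨t, ht⟩
    refine ⟨max s t, fun a ha => ?_⟩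
    rw [smul_add, hs a (Ideal.pow_le_pow_right (le_max_left _ _) ha),
      ht a (Ideal.pow_le_pow_right (le_max_right _ _) ha), add_zero]
  zero_mem' := ⟨0, by simp⟩
  smul_mem' := by
    rintro r x ⟨s, hs⟩
    exact ⟨s, fun a ha => by rw [smul_comm, hs a ha, smul_zero]⟩

lemma mem_gam {N : Type} [AddCommGroup N] [Module R N] {x : N} :
    x ∈ gam J N ↔ ∃ t, ∀ a ∈ J ^ t, a • x = 0 := Iff.rfl

/-- uniform killing on a f.g. submodule -/
lemma gam_uniform {N : Type} [AddCommGroup N] [Module R N] (L : Submodule R N) (hL : L.FG)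
    (h : L ≤ gam J N) : ∃ t, ∀ a ∈ J ^ t, ∀ x ∈ L, a • x = 0 := by
  induction L, hL using Submodule.fg_induction with
  | singleton x =>
    obtain ⟨t, ht⟩ := h (Submodule.mem_span_singleton_self x)
    refine ⟨t, fun a ha y hy => ?_⟩
    obtain ⟨r, rfl⟩ := Submodule.mem_span_singleton.1 hy
    rw [smul_comm, ht a ha, smul_zero]
  | sup L₁ L₂ h1 h2 i1 i2 =>
    obtain ⟨s, hs⟩ := i1 (le_sup_left.trans h)
    obtain ⟨t, ht⟩ := i2 (le_sup_right.trans h)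
    refine ⟨max s t, fun a ha y hy => ?_⟩
    obtain ⟨u, hu, v, hv, rfl⟩ := Submodule.mem_sup.1 hy
    rw [smul_add, hs a (Ideal.pow_le_pow_right (le_max_left _ _) ha) u hu,
      ht a (Ideal.pow_le_pow_right (le_max_right _ _) ha) v hv, add_zero]

lemma exists_inj_ses (N : ModuleCat.{0} R) : ∃ (E : ModuleCat.{0} R) (f : N ⟶ E),
    Function.Injective f ∧ Module.Injective R E := by
  refine ⟨Injective.under N, Injective.ι N, (ModuleCat.mono_iff_injective _).1 inferInstance, ?_⟩
  have : Injective (ModuleCat.of R (Injective.under N : ModuleCat.{0} R)) := Injective.injective_under N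
  exact Module.injective_module_of_injective_object R _

variable [IsNoetherianRing R]

lemma mem_gam_of_mul {N : Type} [AddCommGroup N] [Module R N] {x : N} (s : ℕ)
    (h : ∀ a ∈ J ^ s, a • x ∈ gam J N) : x ∈ gam J N := by
  have hfg : (Submodule.map (LinearMap.toSpanSingleton R N x) (J ^ s)).FG :=
    (IsNoetherian.noetherian (J ^ s)).map _
  obtain ⟨t, ht⟩ := gam_uniform J _ hfg (by
    rintro _ ⟨a, ha, rfl⟩
    exact h a ha)
  refine ⟨t + s, fun c hc => ?_⟩
  rw [pow_add] at hc
  refine Submodule.mul_induction_on hc (fun a ha b hb => ?_) (fun a b ha hb => ?_)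
  · rw [mul_smul]
    exact ht a ha _ ⟨b, hb, rfl⟩
  · rw [add_smul, ha, hb, add_zero]

lemma gam_injective (E : Type) [AddCommGroup E] [Module R E] [Module.Injective R E] :
    Module.Injective R (gam J E) := by
  apply Module.Baer.injective
  intro I g
  have hfg : (LinearMap.range ((gam J E).subtype ∘ₗ g)).FG := by
    rw [LinearMap.range_eq_map]
    exact (IsNoetherian.noetherian (⊤ : Submodule R I)).map _
  obtain ⟨t, ht⟩ := gam_uniform J _ hfg (by
    rintro _ ⟨x, rfl⟩
    exact (g x).2)
  obtain ⟨k, hk⟩ := Ideal.exists_pow_inf_eq_pow_smul J (I : Submodule R R)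
  have hk' := hk (k + t) (by simp)
  rw [Nat.add_sub_cancel_left, smul_eq_mul, smul_eq_mul, Ideal.mul_top] at hk'
  let f : (I ⧸ (Submodule.comap I.subtype (J ^ (k + t)))) →ₗ[R] R ⧸ J ^ (k + t) :=
    Submodule.mapQ _ _ I.subtype le_rfl
  have hf : Function.Injective f := by
    rw [← LinearMap.ker_eq_bot]
    simp only [f, Submodule.mapQ]
    rw [Submodule.ker_liftQ_eq_bot]
    rw [LinearMap.ker_comp, Submodule.ker_mkQ]
  have hker : Submodule.comap I.subtype (J ^ (k + t)) ≤ LinearMap.ker ((gam J E).subtype ∘ₗ g) := by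
    rintro ⟨x, hxI⟩ hx
    have hx2 : x ∈ J ^ (k + t) ⊓ I := ⟨hx, hxI⟩
    rw [hk'] at hx2
    have : ∀ y (hy : y ∈ J ^ t * (J ^ k * ⊤ ⊓ I)), ∃ hyI : y ∈ I, (g ⟨y, hyI⟩ : E) = 0 := by
      intro y hy
      refine Submodule.mul_induction_on hy ?_ ?_
      · rintro a ha b ⟨_, hb⟩
        refine ⟨I.mul_mem_left _ hb, ?_⟩
        have := ht a ha _ ⟨⟨b, hb⟩, rfl⟩
        rw [← map_smul] at this
        exact this
      · rintro a b ⟨ha, ha'⟩ ⟨hb, hb'⟩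
        refine ⟨I.add_mem ha hb, ?_⟩
        have : (⟨a + b, I.add_mem ha hb⟩ : I) = ⟨a, ha⟩ + ⟨b, hb⟩ := rfl
        rw [this, map_add, Submodule.coe_add, ha', hb', add_zero]
    obtain ⟨_, h⟩ := this x (by simpa [Ideal.mul_top] using hx2)
    exact h
  obtain ⟨h, hh⟩ := Module.Injective.out f hf (Submodule.liftQ _ _ hker)
  have hrange : ∀ x : R, (h ∘ₗ (J ^ (k+t)).mkQ) x ∈ gam J E := by
    intro x
    refine ⟨k + t, fun a ha => ?_⟩
    rw [← map_smul]
    have : (Submodule.mkQ (J ^ (k+t))) (a • x) = 0 := by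
      rw [Submodule.mkQ_apply, Submodule.Quotient.mk_eq_zero]
      exact Ideal.mul_mem_right _ _ ha
    rw [LinearMap.comp_apply, this, map_zero]
  refine ⟨LinearMap.codRestrict _ _ hrange, fun x hx => ?_⟩
  apply Subtype.ext
  exact hh (Submodule.Quotient.mk ⟨x, hx⟩)

lemma gam_quot_injective (E : Type) [AddCommGroup E] [Module R E] [Module.Injective R E] :
    Module.Injective R (E ⧸ gam J E) := by
  have := gam_injective J E
  obtain ⟨r, hr⟩ := Module.Injective.out (gam J E).subtype (Submodule.injective_subtype _)
    (LinearMap.id)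
  let s : (E ⧸ gam J E) →ₗ[R] E := Submodule.liftQ _ (LinearMap.id - (gam J E).subtype ∘ₗ r) (by
    intro x hx
    have := hr ⟨x, hx⟩
    simp only [Submodule.subtype_apply, LinearMap.id_apply] at this
    simp [this])
  have hs : ∀ x, (gam J E).mkQ (s x) = x := by
    intro x
    obtain ⟨x, rfl⟩ := Submodule.mkQ_surjective _ x
    simp [s]
  refine ⟨fun X Y _ _ _ _ f hf g => ?_⟩
  obtain ⟨h, hh⟩ := Module.Injective.out f hf (s ∘ₗ g)
  refine ⟨(gam J E).mkQ ∘ₗ h, fun x => ?_⟩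
  simp only [LinearMap.comp_apply, hh, hs]

lemma gam_quot (N : Type) [AddCommGroup N] [Module R N] : gam J (N ⧸ gam J N) = ⊥ := by
  rw [eq_bot_iff]
  intro x hx
  obtain ⟨x, rfl⟩ := Submodule.mkQ_surjective _ x
  obtain ⟨t, ht⟩ := hx
  rw [Submodule.mem_bot, Submodule.mkQ_apply, Submodule.Quotient.mk_eq_zero]
  apply mem_gam_of_mul J t
  intro a ha
  have := ht a ha
  rwa [← map_smul, Submodule.mkQ_apply, Submodule.Quotient.mk_eq_zero] at this

/-- torsion free modules embed in torsion free injectives. -/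
lemma exists_tf (N : ModuleCat.{0} R) (hN : gam J N = ⊥) :
    ∃ S : ShortComplex (ModuleCat.{0} R), S.ShortExact ∧ S.X₁ = N ∧ Injective S.X₂ ∧
      gam J S.X₂ = ⊥ := by
  obtain ⟨E, f, hf, hE⟩ := exists_inj_ses N
  let g : N ⟶ ModuleCat.of R (E ⧸ gam J E) := f ≫ ModuleCat.ofHom (gam J E).mkQ
  have hg : Mono g := by
    rw [ModuleCat.mono_iff_injective]
    rw [injective_iff_map_eq_zero]
    intro x hx
    have h1 : f x ∈ gam J E := (Submodule.Quotient.mk_eq_zero _).1 hx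
    have : x ∈ gam J N := by
      obtain ⟨t, ht⟩ := h1
      refine ⟨t, fun a ha => hf ?_⟩
      rw [map_smul, map_zero, ht a ha]
    rw [hN] at this
    exact this
  refine ⟨ShortComplex.mk g (Limits.cokernel.π g) (Limits.cokernel.condition g),
    ⟨ShortComplex.exact_cokernel g⟩, rfl, ?_, gam_quot J E⟩
  have := gam_quot_injective J E
  exact Module.injective_object_of_injective_module R _

lemma exists_tors (N : ModuleCat.{0} R) (hN : gam J N = ⊤) :
    ∃ S : ShortComplex (ModuleCat.{0} R), S.ShortExact ∧ S.X₁ = N ∧ Injective S.X₂ ∧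
      gam J S.X₂ = ⊤ ∧ gam J S.X₃ = ⊤ := by
  obtain ⟨E, f, hf, hE⟩ := exists_inj_ses N
  have hx : ∀ x, f.hom x ∈ gam J E := by
    intro x
    have : x ∈ gam J N := by rw [hN]; trivial
    obtain ⟨t, ht⟩ := this
    refine ⟨t, fun a ha => ?_⟩
    rw [← map_smul, ht a ha, map_zero]
  let g : N ⟶ ModuleCat.of R (gam J E) := ModuleCat.ofHom (LinearMap.codRestrict _ f.hom hx)
  have hg : Mono g := by
    rw [ModuleCat.mono_iff_injective]
    intro x y hxy
    exact hf (congrArg Subtype.val hxy)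
  have htop : gam J (gam J E) = ⊤ := by
    rw [eq_top_iff]
    rintro ⟨x, t, ht⟩ -
    exact ⟨t, fun a ha => Subtype.ext (ht a ha)⟩
  refine ⟨ShortComplex.mk g (Limits.cokernel.π g) (Limits.cokernel.condition g),
    ⟨ShortComplex.exact_cokernel g⟩, rfl, ?_, htop, ?_⟩
  · have := gam_injective J E
    exact Module.injective_object_of_injective_module R _
  · rw [eq_top_iff]
    rintro x -
    obtain ⟨y, rfl⟩ := (ModuleCat.epi_iff_surjective (Limits.cokernel.π g)).1 inferInstance x
    have : y ∈ gam J (gam J E) := by rw [htop]; trivial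
    obtain ⟨t, ht⟩ := this
    refine ⟨t, fun a ha => ?_⟩
    have := congrArg (Limits.cokernel.π g) (ht a ha)
    rw [map_smul, map_zero] at this
    exact this

end Tors

section VanLemmas
variable {R : Type} [CommRing R] {J : Ideal R}

lemma rmap_comp {I I' I'' : Ideal R} (h : I ≤ I') (h' : I' ≤ I'') :
    rmap h ≫ rmap h' = rmap (h.trans h') := by
  ext
  rfl

/-- Restriction to a higher power of the ideal. -/
def res {t t' : ℕ} (h : t ≤ t') {N : ModuleCat.{0} R} {j : ℕ}
    (α : Abelian.Ext (ModuleCat.of R (R ⧸ J ^ t)) N j) :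
    Abelian.Ext (ModuleCat.of R (R ⧸ J ^ t')) N j :=
  (Abelian.Ext.mk₀ (rmap (Ideal.pow_le_pow_right h : J ^ t' ≤ J ^ t))).comp α (zero_add j)

lemma res_res {t t' t'' : ℕ} (h : t ≤ t') (h' : t' ≤ t'') {N : ModuleCat.{0} R} {j : ℕ}
    (α : Abelian.Ext (ModuleCat.of R (R ⧸ J ^ t)) N j) :
    res h' (res h α) = res (h.trans h') α := by
  unfold res
  rw [Abelian.Ext.mk₀_comp_mk₀_assoc, rmap_comp]

lemma res_comp {t t' : ℕ} (h : t ≤ t') {N N' : ModuleCat.{0} R} {j k l : ℕ}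
    (α : Abelian.Ext (ModuleCat.of R (R ⧸ J ^ t)) N j) (β : Abelian.Ext N N' k) (e : j + k = l) :
    res h (α.comp β e) = (res h α).comp β e := by
  unfold res
  rw [Abelian.Ext.comp_assoc _ _ _ (zero_add j) e (by lia)]

lemma res_zero {t t' : ℕ} (h : t ≤ t') {N : ModuleCat.{0} R} {j : ℕ} :
    res (J := J) h (0 : Abelian.Ext (ModuleCat.of R (R ⧸ J ^ t)) N j) = 0 := by
  simp [res]

lemma van_mid {S : ShortComplex (ModuleCat.{0} R)} (hS : S.ShortExact) {j : ℕ}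
    (h₁ : Van J j S.X₁) (h₃ : Van J j S.X₃) : Van J j S.X₂ := by
  intro t α
  obtain ⟨t', h, h0⟩ := h₃ t (α.comp (Abelian.Ext.mk₀ S.g) (add_zero _))
  change res h _ = 0 at h0
  rw [res_comp] at h0
  obtain ⟨β, hβ⟩ := Abelian.Ext.covariant_sequence_exact₂ _ hS _ h0
  obtain ⟨s, h', h1⟩ := h₁ t' β
  change res h' _ = 0 at h1
  refine ⟨s, h.trans h', ?_⟩
  change res (h.trans h') α = 0
  rw [← res_res h h', ← hβ, res_comp, h1, Abelian.Ext.zero_comp]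

lemma van_right {S : ShortComplex (ModuleCat.{0} R)} (hS : S.ShortExact) {j : ℕ}
    (h₂ : Van J j S.X₂) (h₁ : Van J (j+1) S.X₁) : Van J j S.X₃ := by
  intro t α
  obtain ⟨t', h, h0⟩ := h₁ t (α.comp hS.extClass rfl)
  change res h _ = 0 at h0
  rw [res_comp] at h0
  obtain ⟨β, hβ⟩ := Abelian.Ext.covariant_sequence_exact₃ _ hS _ _ h0
  obtain ⟨s, h', h1⟩ := h₂ t' β
  change res h' _ = 0 at h1
  refine ⟨s, h.trans h', ?_⟩
  change res (h.trans h') α = 0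
  rw [← res_res h h', ← hβ, res_comp, h1, Abelian.Ext.zero_comp]

lemma van_left {S : ShortComplex (ModuleCat.{0} R)} (hS : S.ShortExact) {j : ℕ}
    (h₃ : Van J j S.X₃) (h₂ : Van J (j+1) S.X₂) : Van J (j+1) S.X₁ := by
  intro t α
  obtain ⟨t', h, h0⟩ := h₂ t (α.comp (Abelian.Ext.mk₀ S.f) (add_zero _))
  change res h _ = 0 at h0
  rw [res_comp] at h0
  obtain ⟨β, hβ⟩ := Abelian.Ext.covariant_sequence_exact₁ _ hS _ h0 rfl
  obtain ⟨s, h', h1⟩ := h₃ t' β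
  change res h' _ = 0 at h1
  refine ⟨s, h.trans h', ?_⟩
  change res (h.trans h') α = 0
  rw [← res_res h h', ← hβ, res_comp, h1, Abelian.Ext.zero_comp]

lemma van_iso {N N' : ModuleCat.{0} R} (e : N ≅ N') {j : ℕ} (h : Van J j N) : Van J j N' := by
  intro t α
  obtain ⟨t', h, h0⟩ := h t (α.comp (Abelian.Ext.mk₀ e.inv) (add_zero _))
  change res h _ = 0 at h0
  rw [res_comp] at h0
  refine ⟨t', h, ?_⟩
  change res h α = 0
  have : ((res h α).comp (Abelian.Ext.mk₀ e.inv) (add_zero _)).comp (Abelian.Ext.mk₀ e.hom)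
    (add_zero _) = 0 := by rw [h0, Abelian.Ext.zero_comp]
  simpa using this

lemma van_inj (E : ModuleCat.{0} R) [Injective E] (j : ℕ) : Van J (j+1) E := by
  intro t α
  rw [Abelian.Ext.eq_zero_of_injective α]
  exact ⟨t, le_rfl, by simp⟩

lemma van_of_zero (E : ModuleCat.{0} R) (j : ℕ)
    (h : ∀ t (α : Abelian.Ext (ModuleCat.of R (R ⧸ J ^ t)) E j), α = 0) : Van J j E := by
  intro t α
  rw [h t α]
  exact ⟨t, le_rfl, by simp⟩

lemma ext0_zero (E : ModuleCat.{0} R) (hE : gam J E = ⊥) (L : ModuleCat.{0} R) {t : ℕ}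
    (hL : ∀ a ∈ J ^ t, ∀ x : L, a • x = 0) (α : Abelian.Ext L E 0) : α = 0 := by
  obtain ⟨f, rfl⟩ := (Abelian.Ext.mk₀_bijective L E).2 α
  rw [Abelian.Ext.mk₀_eq_zero_iff]
  ext x
  have : f x ∈ gam J E := ⟨t, fun a ha => by rw [← map_smul, hL a ha, map_zero]⟩
  rw [hE] at this
  exact this

lemma ext_zero_of_tf_inj (E : ModuleCat.{0} R) [Injective E] (hE : gam J E = ⊥)
    (L : ModuleCat.{0} R) {t : ℕ} (hL : ∀ a ∈ J ^ t, ∀ x : L, a • x = 0) (i : ℕ)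
    (α : Abelian.Ext L E i) : α = 0 := by
  cases i with
  | zero => exact ext0_zero E hE L hL α
  | succ i => exact Abelian.Ext.eq_zero_of_injective α

lemma quot_kill (I : Ideal R) (a : R) (ha : a ∈ I) (x : R ⧸ I) : a • x = 0 := by
  obtain ⟨x, rfl⟩ := Ideal.Quotient.mk_surjective x
  have : a • (Ideal.Quotient.mk I x) = Ideal.Quotient.mk I (a * x) := rfl
  rw [this, Ideal.Quotient.eq_zero_iff_mem]
  exact I.mul_mem_right _ ha

lemma van_tf_inj (E : ModuleCat.{0} R) [Injective E] (hE : gam J E = ⊥) (j : ℕ) : Van J j E :=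
  van_of_zero E j fun t α => ext_zero_of_tf_inj E hE _ (fun a ha x => quot_kill (J ^ t) a ha x) j α

/-- homs out of `R/I`. -/
def qhom {I : Ideal R} {N : ModuleCat.{0} R} (x : N) (h : ∀ a ∈ I, a • x = 0) :
    ModuleCat.of R (R ⧸ I) ⟶ N :=
  ModuleCat.ofHom (Submodule.liftQ I (LinearMap.toSpanSingleton R N x) (fun a ha => h a ha))

lemma qhom_one {I : Ideal R} {N : ModuleCat.{0} R} (x : N) (h : ∀ a ∈ I, a • x = 0) :
    (qhom x h).hom (Ideal.Quotient.mk I 1) = x := by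
  exact one_smul R x

lemma qhom_ext {I : Ideal R} {N : ModuleCat.{0} R} (f g : ModuleCat.of R (R ⧸ I) ⟶ N)
    (h : f.hom (Ideal.Quotient.mk I 1) = g.hom (Ideal.Quotient.mk I 1)) : f = g := by
  apply ModuleCat.hom_ext
  apply LinearMap.ext
  intro x
  obtain ⟨x, rfl⟩ := Ideal.Quotient.mk_surjective x
  have : (Ideal.Quotient.mk I x) = x • (Ideal.Quotient.mk I 1) := by
    have : x • (Ideal.Quotient.mk I 1) = Ideal.Quotient.mk I (x * 1) := rfl
    rw [this, mul_one]
  change f.hom _ = g.hom _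
  rw [this]
  exact (map_smul f.hom _ _).trans ((congrArg _ h).trans (map_smul g.hom _ _).symm)

lemma gam_bot_of_van (N : ModuleCat.{0} R) (h : Van J 0 N) : gam J N = ⊥ := by
  rw [eq_bot_iff]
  rintro x ⟨t, ht⟩
  obtain ⟨t', h', h0⟩ := h t (Abelian.Ext.mk₀ (qhom x ht))
  rw [Abelian.Ext.mk₀_comp_mk₀, Abelian.Ext.mk₀_eq_zero_iff] at h0
  have := congr(($h0).hom (Ideal.Quotient.mk _ 1))
  rw [← qhom_one x ht]
  exact this

lemma gam_bot_of_ext (M : ModuleCat.{0} R)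
    (h : ∀ α : Abelian.Ext (ModuleCat.of R (R ⧸ J)) M 0, α = 0) : gam J M = ⊥ := by
  have h1 : ∀ x : M, (∀ a ∈ J, a • x = 0) → x = 0 := by
    intro x hx
    have h0 := h (Abelian.Ext.mk₀ (qhom x hx))
    rw [Abelian.Ext.mk₀_eq_zero_iff] at h0
    have := congr(($h0).hom (Ideal.Quotient.mk _ 1))
    rw [← qhom_one x hx]
    exact this
  rw [eq_bot_iff]
  rintro x ⟨t, ht⟩
  induction t with
  | zero => simpa using ht 1 (by simp)
  | succ t ih =>
    apply ih
    intro a ha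
    apply h1
    intro b hb
    rw [← mul_smul]
    apply ht
    rw [pow_succ, mul_comm b]
    exact Ideal.mul_mem_mul ha hb

/-- the short exact sequence of a submodule. -/
def subSES {N : Type} [AddCommGroup N] [Module R N] (L : Submodule R N) :
    ShortComplex (ModuleCat.{0} R) :=
  ShortComplex.mk (ModuleCat.ofHom L.subtype) (ModuleCat.ofHom L.mkQ) (by
    apply ModuleCat.hom_ext
    apply LinearMap.ext
    intro x
    exact (Submodule.Quotient.mk_eq_zero L).2 x.2)

lemma subSES_exact {N : Type} [AddCommGroup N] [Module R N] (L : Submodule R N) :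
    (subSES L).ShortExact := by
  apply ModuleCat.shortComplex_shortExact
  · intro x
    constructor
    · intro h
      exact ⟨⟨x, (Submodule.Quotient.mk_eq_zero L).1 h⟩, rfl⟩
    · rintro ⟨y, rfl⟩
      exact (Submodule.Quotient.mk_eq_zero L).2 y.2
  · exact Subtype.val_injective
  · exact Submodule.mkQ_surjective L

variable [IsNoetherianRing R]

lemma van_tors (j : ℕ) : ∀ (T : ModuleCat.{0} R), gam J T = ⊤ → Van J (j+1) T := by
  induction j with
  | zero =>
    intro T hT
    obtain ⟨S, hS, rfl, hI, h2, h3⟩ := exists_tors J T hT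
    intro t α
    obtain ⟨γ, hγ⟩ := Abelian.Ext.covariant_sequence_exact₁ _ hS α
      (Abelian.Ext.eq_zero_of_injective _) rfl
    obtain ⟨c, rfl⟩ := (Abelian.Ext.mk₀_bijective _ _).2 γ
    have := hS.epi_g
    obtain ⟨e, he⟩ := (ModuleCat.epi_iff_surjective S.g).1 inferInstance
      (c.hom (Ideal.Quotient.mk _ 1))
    have : e ∈ gam J S.X₂ := by rw [h2]; trivial
    obtain ⟨s, hs⟩ := this
    have hs' : ∀ a ∈ J ^ (max s t), a • e = 0 :=
      fun a ha => hs a (Ideal.pow_le_pow_right (le_max_left _ _) ha)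
    have key : rmap (Ideal.pow_le_pow_right (le_max_right s t) : J ^ (max s t) ≤ J ^ t) ≫ c
        = qhom e hs' ≫ S.g := by
      apply qhom_ext
      change c.hom (Ideal.Quotient.mk _ 1) = S.g.hom ((qhom e hs').hom (Ideal.Quotient.mk _ 1))
      rw [qhom_one]
      exact he.symm
    refine ⟨max s t, le_max_right s t, ?_⟩
    change res (le_max_right s t) _ = 0
    rw [← hγ, res_comp]
    unfold res
    rw [Abelian.Ext.mk₀_comp_mk₀, key, ← Abelian.Ext.mk₀_comp_mk₀,
      Abelian.Ext.comp_assoc_of_second_deg_zero, hS.comp_extClass, Abelian.Ext.comp_zero]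
  | succ j ih =>
    intro T hT
    obtain ⟨S, hS, rfl, hI, h2, h3⟩ := exists_tors J T hT
    exact van_left hS (ih _ h3) (van_inj _ _)

lemma ext_zero_of_allvan (i : ℕ) : ∀ (N : ModuleCat.{0} R), (∀ j, Van J j N) →
    ∀ (L : ModuleCat.{0} R) (t : ℕ), (∀ a ∈ J ^ t, ∀ x : L, a • x = 0) →
    ∀ (α : Abelian.Ext L N i), α = 0 := by
  induction i with
  | zero =>
    intro N hN L t hL α
    exact ext0_zero N (gam_bot_of_van N (hN 0)) L hL α
  | succ i ih =>
    intro N hN L t hL α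
    obtain ⟨S, hS, rfl, hI, h2⟩ := exists_tf J N (gam_bot_of_van N (hN 0))
    obtain ⟨γ, hγ⟩ := Abelian.Ext.covariant_sequence_exact₁ _ hS α
      (Abelian.Ext.eq_zero_of_injective _) rfl
    rw [← hγ, ih S.X₃ (fun j => van_right hS (van_tf_inj _ h2 j) (hN _)) L t hL γ,
      Abelian.Ext.zero_comp]

lemma van_quot_gam (N : ModuleCat.{0} R) {j : ℕ} (h : Van J j N) :
    Van J j (ModuleCat.of R (N ⧸ gam J N)) := by
  refine van_right (subSES_exact (gam J N)) h ?_
  apply van_tors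
  rw [eq_top_iff]
  rintro ⟨x, t, ht⟩ -
  exact ⟨t, fun a ha => Subtype.ext (ht a ha)⟩

/-- Claim 2 -/
lemma claim_two (c : ℕ) : ∀ (N M : ModuleCat.{0} R) (f : N ⟶ M), (∀ j, c ≤ j → Van J j N) →
    (∀ i, i < c → ∀ α : Abelian.Ext (ModuleCat.of R (R ⧸ J)) M i, α = 0) →
    ∀ (L : ModuleCat.{0} R) (t : ℕ), (∀ a ∈ J ^ t, ∀ x : L, a • x = 0) →
    ∀ (i : ℕ) (α : Abelian.Ext L N i), α.comp (Abelian.Ext.mk₀ f) (add_zero i) = 0 := by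
  induction c with
  | zero =>
    intro N M f hN hM L t hL i α
    rw [ext_zero_of_allvan i N (fun j => hN j (Nat.zero_le _)) L t hL α, Abelian.Ext.zero_comp]
  | succ c ih =>
    intro N M f hN hM L t hL i α
    have hMg : gam J M = ⊥ := gam_bot_of_ext M (hM 0 (by lia))
    have main : ∀ (N : ModuleCat.{0} R) (f : N ⟶ M), gam J N = ⊥ →
        (∀ j, c + 1 ≤ j → Van J j N) →
        ∀ (i : ℕ) (α : Abelian.Ext L N i), α.comp (Abelian.Ext.mk₀ f) (add_zero i) = 0 := by
      intro N f hNg hN i α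
      cases i with
      | zero => exact ext0_zero M hMg L hL _
      | succ i =>
        obtain ⟨S, hS, rfl, hI, h2⟩ := exists_tf J N hNg
        obtain ⟨S', hS', rfl, hI', h2'⟩ := exists_tf J M hMg
        have := hS.mono_f
        have := hS.epi_g
        let τ₂ : S.X₂ ⟶ S'.X₂ := Injective.factorThru (f ≫ S'.f) S.f
        have hτ₂ : S.f ≫ τ₂ = f ≫ S'.f := Injective.comp_factorThru _ _
        have hz : S.f ≫ τ₂ ≫ S'.g = 0 := by
          rw [← Category.assoc, hτ₂, Category.assoc, S'.zero, Limits.comp_zero]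
        let φ : S ⟶ S' :=
          { τ₁ := f
            τ₂ := τ₂
            τ₃ := hS.exact.desc (τ₂ ≫ S'.g) hz
            comm₁₂ := hτ₂.symm
            comm₂₃ := (hS.exact.g_desc _ _).symm }
        obtain ⟨γ, hγ⟩ := Abelian.Ext.covariant_sequence_exact₁ _ hS α
          (Abelian.Ext.eq_zero_of_injective _) rfl
        have hnat := ShortComplex.ShortExact.extClass_naturality hS hS' φ
        have hih := ih S.X₃ S'.X₃ φ.τ₃
          (fun j hj => van_right hS (van_tf_inj _ h2 j) (hN _ (by lia)))
          (fun i hi x => by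
            obtain ⟨y, hy⟩ := Abelian.Ext.covariant_sequence_exact₃ _ hS' x rfl
              (hM (i+1) (by lia) _)
            rw [← hy, ext_zero_of_tf_inj _ h2' _ (t := 1)
              (fun a ha x => quot_kill J a (by simpa using ha) x) i y, Abelian.Ext.zero_comp])
          L t hL i γ
        change α.comp (Abelian.Ext.mk₀ φ.τ₁) (add_zero _) = 0
        rw [← hγ, Abelian.Ext.comp_assoc_of_third_deg_zero, hnat,
          ← Abelian.Ext.comp_assoc_of_second_deg_zero, hih, Abelian.Ext.zero_comp]
    have hk : gam J N ≤ LinearMap.ker f.hom := by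
      rintro x ⟨s, hs⟩
      have : f.hom x ∈ gam J M := ⟨s, fun a ha => by rw [← map_smul, hs a ha, map_zero]⟩
      rw [hMg] at this
      exact this
    let π : N ⟶ ModuleCat.of R (N ⧸ gam J N) := ModuleCat.ofHom (gam J N).mkQ
    let f' : ModuleCat.of R (N ⧸ gam J N) ⟶ M := ModuleCat.ofHom ((gam J N).liftQ f.hom hk)
    have hf : f = π ≫ f' := by
      apply ModuleCat.hom_ext
      apply LinearMap.ext
      intro x
      rfl
    rw [hf, ← Abelian.Ext.mk₀_comp_mk₀, ← Abelian.Ext.comp_assoc_of_third_deg_zero]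
    exact main _ f' (gam_quot J N) (fun j hj => van_quot_gam N (hN j hj)) i _

end VanLemmas

section ClaimOne
variable {R : Type} [CommRing R] {J : Ideal R} [IsNoetherianRing R]

lemma filt (i : ℕ) (I : Ideal R)
    (hp : ∀ q : Ideal R, q.IsPrime → I ≤ q → Van J i (ModuleCat.of R (R ⧸ q)))
    (N : Type) [AddCommGroup N] [Module R N] [hN : Module.Finite R N]
    (hk : ∀ a ∈ I, ∀ x : N, a • x = 0) : Van J i (ModuleCat.of R N) := by
  revert hk
  refine IsNoetherianRing.induction_on_isQuotientEquivQuotientPrime R hN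
    (motive := fun N _ _ _ => (∀ a ∈ I, ∀ x : N, a • x = 0) → Van J i (ModuleCat.of R N))
    ?_ ?_ ?_
  · intro N _ _ _ _ _
    apply van_of_zero
    intro t α
    have h0 : Limits.IsZero (ModuleCat.of R N) := ModuleCat.isZero_of_subsingleton _
    have : α = α.comp (Abelian.Ext.mk₀ (𝟙 _)) (add_zero _) := by simp
    rw [this, h0.eq_of_src (𝟙 _) 0]
    simp
  · intro N _ _ _ p e hk
    refine van_iso e.symm.toModuleIso (hp p.1 p.2 ?_)
    intro a ha
    have h1 := hk a ha (e.symm (Ideal.Quotient.mk _ 1))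
    rw [← map_smul, e.symm.map_eq_zero_iff] at h1
    have h2 : a • (Ideal.Quotient.mk p.asIdeal 1) = Ideal.Quotient.mk _ (a * 1) := rfl
    rw [h2, mul_one, Ideal.Quotient.eq_zero_iff_mem] at h1
    exact h1
  · intro N₁ _ _ _ N₂ _ _ _ N₃ _ _ _ f g hf hg hfg ih1 ih3 hk
    have hS : (ModuleCat.shortComplexOfCompEqZero f g hfg.linearMap_comp_eq_zero).ShortExact :=
      ModuleCat.shortComplex_shortExact _ hfg hf hg
    refine van_mid hS (ih1 ?_) (ih3 ?_)
    · intro a ha x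
      apply hf
      rw [map_smul, hk a ha, map_zero]
    · intro a ha x
      obtain ⟨x, rfl⟩ := hg x
      rw [← map_smul, hk a ha, map_zero]

lemma exists_hom (M : Type) [AddCommGroup M] [Module R M] [Module.Finite R M]
    (q : Ideal R) [hq : q.IsPrime] (h : Module.annihilator R M ≤ q) :
    ∃ f : M →ₗ[R] R ⧸ q, f ≠ 0 := by
  by_contra! hc
  have : Subsingleton (M →ₗ[R] R ⧸ q) := subsingleton_of_forall_eq 0 hc
  obtain ⟨r, hr, hreg⟩ := IsSMulRegular.subsingleton_linearMap_iff.1 this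
  have h1 := hreg (a₁ := Ideal.Quotient.mk q 1) (a₂ := 0) (by
    change r • _ = r • (0 : R ⧸ q)
    rw [smul_zero]
    exact quot_kill q r (h hr) _)
  rw [Ideal.Quotient.eq_zero_iff_mem] at h1
  exact hq.ne_top ((Ideal.eq_top_iff_one _).2 h1)

lemma claim_one_step (M : Type) [AddCommGroup M] [Module R M] [Module.Finite R M] (i : ℕ)
    (hM : Van J i (ModuleCat.of R M))
    (H : ∀ (N : Type) [AddCommGroup N] [Module R N] [Module.Finite R N],
      (∀ a ∈ Module.annihilator R M, ∀ x : N, a • x = 0) → Van J (i+1) (ModuleCat.of R N))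
    (q : Ideal R) (hq : q.IsPrime) (hMq : Module.annihilator R M ≤ q) :
    Van J i (ModuleCat.of R (R ⧸ q)) := by
  induction q using WellFoundedGT.induction with
  | ind q ih =>
  obtain ⟨f, hf⟩ := exists_hom M q hMq
  have h1 : Van J i (ModuleCat.of R (M ⧸ LinearMap.ker f)) := by
    refine van_right (subSES_exact (LinearMap.ker f)) hM (H _ ?_)
    intro a ha x
    apply Subtype.ext
    exact Module.mem_annihilator.1 ha x.1
  have h2 : Van J i (ModuleCat.of R (LinearMap.range f)) :=
    van_iso f.quotKerEquivRange.toModuleIso h1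
  refine van_mid (subSES_exact (LinearMap.range f)) h2 ?_
  have hx : ∃ b, b ∉ q ∧ Ideal.Quotient.mk q b ∈ LinearMap.range f := by
    by_contra! hc
    apply hf
    ext x
    obtain ⟨b, hb⟩ := Ideal.Quotient.mk_surjective (f x)
    by_cases hbq : b ∈ q
    · rw [← hb, Ideal.Quotient.eq_zero_iff_mem.2 hbq]; rfl
    · exact absurd ⟨x, hb.symm⟩ (hc b hbq)
  obtain ⟨b, hb, hbr⟩ := hx
  refine filt i (q ⊔ Ideal.span {b}) ?_ ((R ⧸ q) ⧸ LinearMap.range f) ?_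
  · intro q' hq' hle
    refine ih q' ?_ hq' (hMq.trans (le_sup_left.trans hle))
    refine lt_of_le_of_ne (le_sup_left.trans hle) ?_
    rintro rfl
    exact hb (hle (Ideal.mem_sup_right (Ideal.mem_span_singleton_self b)))
  · intro a ha x
    obtain ⟨x, rfl⟩ := Submodule.mkQ_surjective _ x
    obtain ⟨x, rfl⟩ := Ideal.Quotient.mk_surjective x
    rw [← map_smul, Submodule.mkQ_apply, Submodule.Quotient.mk_eq_zero]
    obtain ⟨c, hc, d, hd, rfl⟩ := Submodule.mem_sup.1 ha
    obtain ⟨e, rfl⟩ := Ideal.mem_span_singleton'.1 hd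
    rw [add_smul, quot_kill q c hc, zero_add]
    have : (e * b) • (Ideal.Quotient.mk q x) = (e * x) • (Ideal.Quotient.mk q b) := by
      change Ideal.Quotient.mk q (e * b * x) = Ideal.Quotient.mk q (e * x * b)
      ring_nf
    rw [this]
    exact Submodule.smul_mem _ _ hbr

lemma claim_one (n : ℕ) (hn : ∀ j, n < j → ∀ N : ModuleCat.{0} R, Van J j N)
    (M : Type) [AddCommGroup M] [Module R M] [Module.Finite R M] (c : ℕ)
    (hM : ∀ i, c < i → Van J i (ModuleCat.of R M)) (d : ℕ) :
    ∀ i, c < i → n < i + d → ∀ (N : Type) [AddCommGroup N] [Module R N] [Module.Finite R N],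
      (∀ a ∈ Module.annihilator R M, ∀ x : N, a • x = 0) → Van J i (ModuleCat.of R N) := by
  induction d with
  | zero =>
    intro i _ hi N _ _ _ _
    exact hn i hi _
  | succ d ih =>
    intro i hc hi N _ _ _ hN
    refine filt i (Module.annihilator R M) ?_ N hN
    intro q hq hle
    exact claim_one_step M i (hM i hc) (fun N _ _ _ h => ih (i+1) (by lia) (by lia) N h) q hq hle

end ClaimOne

section Koszul
variable {R : Type} [CommRing R]

def toSp {N : ModuleCat.{0} R} (x : N) : ModuleCat.of R R ⟶ N :=
  ModuleCat.ofHom (LinearMap.toSpanSingleton R N x)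

lemma toSp_sub_smul {N : ModuleCat.{0} R} (x z : N) (y : R) :
    toSp (x - y • z) = toSp x - y • toSp z := by
  ext
  simp [toSp]

lemma toSp_comp {N N' : ModuleCat.{0} R} (x : N) (f : N ⟶ N') :
    toSp x ≫ f = toSp (f.hom x) := by
  ext
  simp [toSp]

/-- Koszul type property of the ideal `I`. -/
def Kos (I : Ideal R) (k : ℕ) : Prop :=
  (∀ (N : ModuleCat.{0} R) (i : ℕ), k < i →
    ∀ α : Abelian.Ext (ModuleCat.of R (R ⧸ I)) N i, α = 0) ∧
  ∃ e : Abelian.Ext (ModuleCat.of R (R ⧸ I)) (ModuleCat.of R R) k,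
    (∀ (N : ModuleCat.{0} R) (β : Abelian.Ext (ModuleCat.of R (R ⧸ I)) N k),
      ∃ x : N, e.comp (Abelian.Ext.mk₀ (toSp x)) (add_zero k) = β) ∧
    (∀ (N : ModuleCat.{0} R) (x : N), e.comp (Abelian.Ext.mk₀ (toSp x)) (add_zero k) = 0 →
      x ∈ I • (⊤ : Submodule R N))

lemma kos_bot : Kos (⊥ : Ideal R) 0 := by
  let q : (R ⧸ (⊥ : Ideal R)) ≃ₗ[R] R := Submodule.quotEquivOfEqBot ⊥ rfl
  refine ⟨?_, Abelian.Ext.mk₀ (ModuleCat.ofHom q.toLinearMap), ?_, ?_⟩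
  · intro N i hi α
    obtain ⟨i, rfl⟩ : ∃ j, i = j + 1 := ⟨i - 1, by lia⟩
    have hp : Projective (ModuleCat.of R (R ⧸ (⊥ : Ideal R))) := by
      have : Module.Projective R (R ⧸ (⊥ : Ideal R)) := Module.Projective.of_equiv q.symm
      exact ModuleCat.projective_of_categoryTheory_projective _
    exact Abelian.Ext.eq_zero_of_projective α
  · intro N β
    obtain ⟨g, rfl⟩ := (Abelian.Ext.mk₀_bijective _ _).2 β
    refine ⟨g.hom (Ideal.Quotient.mk _ 1), ?_⟩
    rw [Abelian.Ext.mk₀_comp_mk₀]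
    congr 1
    apply qhom_ext
    exact one_smul R _
  · intro N x h
    rw [Abelian.Ext.mk₀_comp_mk₀, Abelian.Ext.mk₀_eq_zero_iff] at h
    have h1 := congr(($h).hom (Ideal.Quotient.mk _ 1))
    have h2 : (1 : R) • x = 0 := h1
    rw [one_smul] at h2
    rw [h2]
    exact zero_mem _

lemma kos_step (I : Ideal R) (k : ℕ) (y : R) (hy : ∀ b, y * b ∈ I → b ∈ I) (h : Kos I k) :
    Kos (I ⊔ Ideal.span {y}) (k+1) := by
  let f : (R ⧸ I) →ₗ[R] (R ⧸ I) := y • LinearMap.id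
  let g : (R ⧸ I) →ₗ[R] (R ⧸ (I ⊔ Ideal.span {y})) := Submodule.mapQ _ _ LinearMap.id le_sup_left
  have hgf : Function.Exact f g := by
    intro x
    obtain ⟨x, rfl⟩ := Ideal.Quotient.mk_surjective x
    constructor
    · intro h
      have h1 : x ∈ I ⊔ Ideal.span {y} := Ideal.Quotient.eq_zero_iff_mem.1 h
      obtain ⟨c, hc, d, hd, rfl⟩ := Submodule.mem_sup.1 h1
      obtain ⟨e, rfl⟩ := Ideal.mem_span_singleton'.1 hd
      refine ⟨Ideal.Quotient.mk _ e, ?_⟩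
      change Ideal.Quotient.mk I (y * e) = _
      rw [Ideal.Quotient.eq]
      have : y * e - (c + e * y) = - c := by ring
      rw [this]
      exact neg_mem hc
    · rintro ⟨z, hz⟩
      obtain ⟨z, rfl⟩ := Ideal.Quotient.mk_surjective z
      rw [← hz]
      change Ideal.Quotient.mk (I ⊔ Ideal.span {y}) (y * z) = 0
      rw [Ideal.Quotient.eq_zero_iff_mem]
      exact Ideal.mul_mem_right _ _ (Ideal.mem_sup_right (Ideal.mem_span_singleton_self y))
  have hf : Function.Injective f := by
    rw [injective_iff_map_eq_zero]
    intro x hx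
    obtain ⟨x, rfl⟩ := Ideal.Quotient.mk_surjective x
    have h1 : Ideal.Quotient.mk I (y * x) = 0 := hx
    rw [Ideal.Quotient.eq_zero_iff_mem] at h1 ⊢
    exact hy x h1
  have hg : Function.Surjective g := by
    intro x
    obtain ⟨x, rfl⟩ := Ideal.Quotient.mk_surjective x
    exact ⟨Ideal.Quotient.mk _ x, rfl⟩
  let S := ModuleCat.shortComplexOfCompEqZero f g hgf.linearMap_comp_eq_zero
  have hS : S.ShortExact := ModuleCat.shortComplex_shortExact _ hgf hf hg
  have hSf : S.f = y • 𝟙 (ModuleCat.of R (R ⧸ I)) := rfl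
  obtain ⟨ha, e, hb, hc⟩ := h
  refine ⟨?_, hS.extClass.comp e (add_comm 1 k), ?_, ?_⟩
  · intro N i hi α
    obtain ⟨i, rfl⟩ : ∃ j, i = j + 1 := ⟨i - 1, by lia⟩
    obtain ⟨β, hβ⟩ := Abelian.Ext.contravariant_sequence_exact₃ hS N α (ha _ _ (by lia) _)
      (add_comm 1 i)
    rw [← hβ, ha N i (by lia) β, Abelian.Ext.comp_zero]
  · intro N α
    obtain ⟨β, hβ⟩ := Abelian.Ext.contravariant_sequence_exact₃ hS N α (ha _ _ (by lia) _)
      (add_comm 1 k)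
    obtain ⟨x, hx⟩ := hb N β
    refine ⟨x, ?_⟩
    rw [Abelian.Ext.comp_assoc_of_third_deg_zero, hx, hβ]
  · intro N x hx
    rw [Abelian.Ext.comp_assoc_of_third_deg_zero] at hx
    obtain ⟨z, hz⟩ := Abelian.Ext.contravariant_sequence_exact₁ hS N _ (add_comm 1 k) hx
    obtain ⟨x', rfl⟩ := hb N z
    have h1 : (Abelian.Ext.mk₀ S.f).comp (e.comp (Abelian.Ext.mk₀ (toSp x')) (add_zero k))
        (zero_add k) = y • (e.comp (Abelian.Ext.mk₀ (toSp x')) (add_zero k)) := by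
      rw [hSf, Abelian.Ext.mk₀_smul, Abelian.Ext.smul_comp]
      congr 1
      exact Abelian.Ext.mk₀_id_comp _
    rw [h1] at hz
    have h2 : e.comp (Abelian.Ext.mk₀ (toSp (x - y • x'))) (add_zero k) = 0 := by
      rw [toSp_sub_smul, sub_eq_add_neg, Abelian.Ext.mk₀_add, Abelian.Ext.mk₀_neg,
        Abelian.Ext.mk₀_smul, Abelian.Ext.comp_add, Abelian.Ext.comp_neg, Abelian.Ext.comp_smul,
        hz, add_neg_cancel]
    have h3 := hc N _ h2
    have : x = (x - y • x') + y • x' := by abel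
    rw [this]
    refine add_mem (Submodule.smul_mono_left le_sup_left h3) ?_
    exact Submodule.smul_mem_smul (Ideal.mem_sup_right (Ideal.mem_span_singleton_self y)) trivial

end Koszul

section Final
variable {K : Type} [Field K] {m n : ℕ}

def powI (K : Type) [Field K] (m n t k : ℕ) : Ideal (BGS K m n) :=
  Ideal.span ((fun s => monomial s (1 : K)) ''
    ((fun j : Fin n => Finsupp.single (Sum.inr j : Fin m ⊕ Fin n) t) '' {j | j.val < k}))

lemma powI_zero (t : ℕ) : powI K m n t 0 = ⊥ := by
  simp [powI]

lemma powI_succ (t k : ℕ) (hk : k < n) :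
    powI K m n t (k+1) = powI K m n t k ⊔ Ideal.span {X (Sum.inr ⟨k, hk⟩) ^ t} := by
  have h : {j : Fin n | j.val < k + 1} = {j : Fin n | j.val < k} ∪ {⟨k, hk⟩} := by
    ext j
    simp only [Set.mem_ofPred_eq, Set.union_singleton, Set.mem_insert_iff, Fin.ext_iff]
    lia
  unfold powI
  rw [h, Set.image_union, Set.image_union, Ideal.span_union, Set.image_singleton,
    Set.image_singleton, X_pow_eq_monomial]

lemma powI_reg (t k : ℕ) (hk : k < n) (b : BGS K m n)
    (hb : X (Sum.inr ⟨k, hk⟩) ^ t * b ∈ powI K m n t k) : b ∈ powI K m n t k := by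
  unfold powI at *
  rw [mem_ideal_span_monomial_image] at *
  intro xi hxi
  obtain ⟨si, hsi, hle⟩ := hb (Finsupp.single (Sum.inr ⟨k, hk⟩) t + xi) (by
    rw [mem_support_iff] at *
    rwa [X_pow_eq_monomial, coeff_monomial_mul, one_mul])
  refine ⟨si, hsi, ?_⟩
  obtain ⟨j, hj, rfl⟩ := hsi
  simp only [Finsupp.single_le_iff] at *
  have hne : (Sum.inr ⟨k, hk⟩ : Fin m ⊕ Fin n) ≠ Sum.inr j := by
    intro h
    have := Sum.inr_injective h
    subst this
    simp at hj
  rw [Finsupp.add_apply, Finsupp.single_eq_of_ne' hne, zero_add] at hle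
  exact hle

lemma kos_powI (t k : ℕ) (hk : k ≤ n) : Kos (powI K m n t k) k := by
  induction k with
  | zero => rw [powI_zero]; exact kos_bot
  | succ k ih =>
    rw [powI_succ t k hk]
    exact kos_step _ _ _ (powI_reg t k hk) (ih (by lia))

lemma powI_le (t : ℕ) : powI K m n t n ≤ idealQ K m n ^ t := by
  unfold powI
  rw [Ideal.span_le]
  rintro _ ⟨_, ⟨j, hj, rfl⟩, rfl⟩
  simp only [← X_pow_eq_monomial]
  have h1 : (X (Sum.inr j) : BGS K m n) ∈ idealQ K m n := Ideal.subset_span ⟨j, rfl⟩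
  exact Ideal.pow_mem_pow h1 t

lemma le_powI (t : ℕ) : ∃ s, idealQ K m n ^ s ≤ powI K m n t n := by
  apply Ideal.exists_pow_le_of_le_radical_of_fg
  · unfold idealQ
    rw [Ideal.span_le]
    rintro _ ⟨j, rfl⟩
    refine ⟨t, ?_⟩
    apply Ideal.subset_span
    refine ⟨_, ⟨j, j.2, rfl⟩, ?_⟩
    simp only [← X_pow_eq_monomial]
  · exact IsNoetherian.noetherian _

lemma van_big (j : ℕ) (hj : n < j) (N : ModuleCat.{0} (BGS K m n)) : Van (idealQ K m n) j N := by
  intro t α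
  obtain ⟨s, hs⟩ := le_powI (K := K) (m := m) (n := n) t
  refine ⟨s + t, by lia, ?_⟩
  have h1 : idealQ K m n ^ (s + t) ≤ powI K m n t n :=
    (Ideal.pow_le_pow_right (by lia)).trans hs
  have h2 := rmap_comp h1 (powI_le (K := K) (m := m) (n := n) t)
  have h3 := (kos_powI (K := K) (m := m) (n := n) t n le_rfl).1 N j hj
    ((Abelian.Ext.mk₀ (rmap (powI_le (K := K) (m := m) (n := n) t))).comp α (zero_add j))
  rw [← h2, ← Abelian.Ext.mk₀_comp_mk₀_assoc, h3, Abelian.Ext.comp_zero]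

variable {M : Type} [AddCommGroup M] [Module (BGS K m n) M] {ℳ : ℕ × ℕ → AddSubgroup M}

def filG (ℳ : ℕ × ℕ → AddSubgroup M) (t : ℕ) : AddSubgroup M :=
  ⨆ d : {d : ℕ × ℕ // t ≤ d.2}, ℳ d.1

lemma filG_top (hM : IsBigrading K m n M ℳ) : filG ℳ 0 = ⊤ := by
  rw [eq_top_iff]
  intro x _
  obtain ⟨z, rfl⟩ := hM.internal.2 x
  induction z using DirectSum.induction_on with
  | zero => rw [map_zero]; exact zero_mem _
  | of d x =>
    rw [DirectSum.coeAddMonoidHom_of]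
    exact le_iSup (fun d : {d : ℕ × ℕ // 0 ≤ d.2} => ℳ d.1) ⟨d, Nat.zero_le _⟩ x.2
  | add x y hx hy => rw [map_add]; exact add_mem (hx trivial) (hy trivial)

lemma filG_mono_smul (hM : IsBigrading K m n M ℳ) (t : ℕ) (d : ℕ × ℕ) (s : BGS K m n)
    (hs : IsWeightedHomogeneous (bwt m n) s d) (x : M) (hx : x ∈ filG ℳ t) :
    s • x ∈ filG ℳ (d.2 + t) := by
  unfold filG at hx
  induction hx using AddSubgroup.iSup_induction' with
  | hp i x hx =>
    have := hM.smul_mem d i.1 s x hs hx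
    exact (le_iSup (fun d' : {d' : ℕ × ℕ // d.2 + t ≤ d'.2} => ℳ d'.1)
      ⟨d + i.1, by have := i.2; simp; lia⟩) this
  | h1 => rw [smul_zero]; exact zero_mem _
  | hadd x y _ _ hx hy => rw [smul_add]; exact add_mem hx hy

lemma filG_anti {t t' : ℕ} (h : t ≤ t') : filG ℳ t' ≤ filG ℳ t := by
  unfold filG
  rw [iSup_le_iff]
  intro d
  exact le_iSup (fun d : {d : ℕ × ℕ // t ≤ d.2} => ℳ d.1) ⟨d.1, h.trans d.2⟩

def filS (hM : IsBigrading K m n M ℳ) (t : ℕ) : Submodule (BGS K m n) M :=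
  { filG ℳ t with
    smul_mem' := by
      intro s x hx
      change s • x ∈ filG ℳ t
      rw [s.as_sum, Finset.sum_smul]
      refine sum_mem fun d _ => ?_
      exact filG_anti (Nat.le_add_left _ _) (filG_mono_smul hM t _ _
        (isWeightedHomogeneous_monomial (bwt m n) d _ rfl) x hx) }

lemma powQ_smul_le (hM : IsBigrading K m n M ℳ) (t : ℕ) :
    idealQ K m n ^ t • (⊤ : Submodule (BGS K m n) M) ≤ filS hM t := by
  induction t with
  | zero =>
    intro x _
    change x ∈ filG ℳ 0
    rw [filG_top hM]
    trivial
  | succ t ih =>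
    rw [pow_succ', Submodule.mul_smul]
    refine (Submodule.smul_mono le_rfl ih).trans ?_
    rw [Submodule.smul_le]
    intro r hr y hy
    unfold idealQ at hr
    induction hr using Submodule.span_induction with
    | mem r hr =>
      obtain ⟨j, rfl⟩ := hr
      have h := filG_mono_smul hM t _ _ (isWeightedHomogeneous_X K (bwt m n) (Sum.inr j)) y hy
      have h1 : (bwt m n (Sum.inr j)).2 + t = t + 1 := by simp [bwt, add_comm]
      rw [h1] at h
      exact h
    | zero => rw [zero_smul]; exact zero_mem _
    | add a b _ _ ha hb => rw [add_smul]; exact add_mem ha hb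
    | smul a b _ hb => rw [smul_assoc]; exact Submodule.smul_mem _ _ hb

lemma eq_zero_of_all (hM : IsBigrading K m n M ℳ) (x : M)
    (hx : ∀ t, x ∈ idealQ K m n ^ t • (⊤ : Submodule (BGS K m n) M)) : x = 0 := by
  let e := AddEquiv.ofBijective (DirectSum.coeAddMonoidHom ℳ) hM.internal
  have h1 : ∀ t, ∀ x ∈ filG ℳ t, ∀ d : ℕ × ℕ, d.2 < t → (e.symm x) d = 0 := by
    intro t x hx d hd
    unfold filG at hx
    induction hx using AddSubgroup.iSup_induction' with
    | hp i x hx =>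
      have : e.symm x = DirectSum.of (fun i => ℳ i) i.1 ⟨x, hx⟩ := by
        rw [AddEquiv.symm_apply_eq]
        exact (DirectSum.coeAddMonoidHom_of ℳ i.1 ⟨x, hx⟩).symm
      rw [this, DirectSum.of_eq_of_ne]
      rintro rfl
      have := i.2
      lia
    | h1 => rw [map_zero]; rfl
    | hadd x y _ _ hx hy => rw [map_add, DirectSum.add_apply, hx, hy, add_zero]
  have h2 : e.symm x = 0 := by
    ext1 d
    exact h1 (d.2 + 1) x (powQ_smul_le hM _ (hx _)) d (by lia)
  simpa using h2

lemma van_of_cohDim (N : Type) [AddCommGroup N] [Module (BGS K m n) N] (i : ℕ)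
    (hi : cohDim (BGS K m n) (idealQ K m n) N < i) :
    Van (idealQ K m n) i (ModuleCat.of (BGS K m n) N) := by
  rw [van_iff, ← not_nontrivial_iff_subsingleton]
  intro h
  unfold cohDim at hi
  refine absurd (le_csSup ⟨n, ?_⟩ h) (not_le.2 hi)
  intro j hj
  by_contra hlt
  have h1 := (van_iff _ _ _).1 (van_big (K := K) (m := m) j (not_le.1 hlt)
    (ModuleCat.of (BGS K m n) N))
  exact not_nontrivial_iff_subsingleton.2 h1 hj

lemma cohDim_le (N : Type) [AddCommGroup N] [Module (BGS K m n) N] (g : ℕ)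
    (h : ∀ i, g < i → Van (idealQ K m n) i (ModuleCat.of (BGS K m n) N)) :
    cohDim (BGS K m n) (idealQ K m n) N ≤ g := by
  unfold cohDim
  refine csSup_le' ?_
  intro j hj
  by_contra hlt
  exact not_nontrivial_iff_subsingleton.2 ((van_iff _ _ _).1 (h j (not_le.1 hlt))) hj

lemma ext_of_lt (N : Type) [AddCommGroup N] [Module (BGS K m n) N] (i : ℕ)
    (hi : i < extGrade (BGS K m n) (idealQ K m n) N)
    (α : Abelian.Ext (ModuleCat.of (BGS K m n) (BGS K m n ⧸ idealQ K m n))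
      (ModuleCat.of (BGS K m n) N) i) : α = 0 := by
  unfold extGrade at hi
  have h := Nat.notMem_of_lt_sInf hi
  have h1 : Subsingleton (oldExt (ModuleCat.of (BGS K m n) (BGS K m n ⧸ idealQ K m n))
      (ModuleCat.of (BGS K m n) N) i) := not_nontrivial_iff_subsingleton.1 h
  have h2 := oldExt_subsingleton_iff.1 h1
  exact Subsingleton.elim _ _

lemma main_eq [Module.Finite (BGS K m n) M] (hM : IsBigrading K m n M ℳ)
    (hCM : extGrade (BGS K m n) (idealQ K m n) M = cohDim (BGS K m n) (idealQ K m n) M)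
    (p : Ideal (BGS K m n)) (hp : p ∈ associatedPrimes (BGS K m n) M) :
    extGrade (BGS K m n) (idealQ K m n) M
      = cohDim (BGS K m n) (idealQ K m n) (BGS K m n ⧸ p) := by
  obtain ⟨hpp, x, hx⟩ := isAssociatedPrime_iff.1 hp
  have hmem : ∀ a, a ∈ p ↔ a • x = 0 := by
    intro a
    rw [hx, Submodule.mem_colon_singleton, Submodule.mem_bot]
  have hx0 : x ≠ 0 := by
    rintro rfl
    exact hpp.ne_top ((Ideal.eq_top_iff_one _).2 ((hmem 1).2 (smul_zero _)))
  apply le_antisymm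
  · by_contra! hlt
    apply hx0
    apply eq_zero_of_all hM
    intro t
    let f : ModuleCat.of (BGS K m n) (BGS K m n ⧸ p) ⟶ ModuleCat.of (BGS K m n) M :=
      qhom (N := ModuleCat.of (BGS K m n) M) x (fun a ha => (hmem a).1 ha)
    obtain ⟨s, hs⟩ := le_powI (K := K) (m := m) (n := n) t
    obtain ⟨-, e, -, he⟩ := kos_powI (K := K) (m := m) (n := n) t n le_rfl
    let y : ModuleCat.of (BGS K m n) (BGS K m n ⧸ p) := Ideal.Quotient.mk p 1
    have h2 := claim_two (J := idealQ K m n)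
      (cohDim (BGS K m n) (idealQ K m n) (BGS K m n ⧸ p) + 1) _ _ f
      (fun j hj => van_of_cohDim _ j hj)
      (fun i hi α => ext_of_lt M i ((Nat.lt_succ_iff.1 hi).trans_lt hlt) α)
      (ModuleCat.of (BGS K m n) (BGS K m n ⧸ powI K m n t n)) s
      (fun a ha z => quot_kill _ a (hs ha) z) n
      (e.comp (Abelian.Ext.mk₀ (toSp y)) (add_zero n))
    rw [Abelian.Ext.comp_assoc_of_third_deg_zero, Abelian.Ext.mk₀_comp_mk₀, toSp_comp] at h2
    have h3 : f.hom y = x := qhom_one (N := ModuleCat.of (BGS K m n) M) x _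
    rw [h3] at h2
    exact Submodule.smul_mono_left (powI_le t) (he (ModuleCat.of (BGS K m n) M) x h2)
  · apply cohDim_le
    intro i hi
    refine claim_one n (fun j hj N => van_big j hj N) M _ (fun i hi => van_of_cohDim M i hi)
      (n + 1) i (hCM ▸ hi) (by lia) _ ?_
    intro a ha z
    refine quot_kill p a ((hmem a).2 ?_) z
    exact Module.mem_annihilator.1 ha x

end Final

theorem cm_wrt_Q_implies_maximalDepth
    (K : Type) [Field K] (m n : ℕ)
    (M : Type) [AddCommGroup M] [Module (BGS K m n) M] [Module.Finite (BGS K m n) M]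
    (ℳ : ℕ × ℕ → AddSubgroup M) (hM : IsBigrading K m n M ℳ)
    (hCM : extGrade (BGS K m n) (idealQ K m n) M = cohDim (BGS K m n) (idealQ K m n) M) :
    (∀ p ∈ associatedPrimes (BGS K m n) M,
      extGrade (BGS K m n) (idealQ K m n) M
        = cohDim (BGS K m n) (idealQ K m n) (BGS K m n ⧸ p)) ∧
    HasMaximalDepth (BGS K m n) (idealQ K m n) M := by
  have h1 := main_eq hM hCM
  refine ⟨h1, ?_⟩
  unfold HasMaximalDepth mCohDim
  by_cases hne : (associatedPrimes (BGS K m n) M).Nonempty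
  · have h2 : (fun p => cohDim (BGS K m n) (idealQ K m n) (BGS K m n ⧸ p)) ''
        associatedPrimes (BGS K m n) M = {extGrade (BGS K m n) (idealQ K m n) M} := by
      rw [← hne.image_const]
      exact Set.image_congr fun p hp => (h1 p hp).symm
    rw [h2, csInf_singleton]
  · have hs : Subsingleton M := by
      rw [← not_nontrivial_iff_subsingleton]
      intro h
      exact hne (associatedPrimes.nonempty _ _)
    rw [Set.not_nonempty_iff_eq_empty.1 hne, Set.image_empty, Nat.sInf_empty]
    have hz : Limits.IsZero (ModuleCat.of (BGS K m n) M) := ModuleCat.isZero_of_subsingleton _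
    have he : {i : ℕ | Nontrivial (((Ext (BGS K m n) (ModuleCat (BGS K m n)) i).obj
        (Opposite.op (ModuleCat.of (BGS K m n) (BGS K m n ⧸ idealQ K m n)))).obj
        (ModuleCat.of (BGS K m n) M))} = ∅ := by
      rw [Set.eq_empty_iff_forall_notMem]
      intro i hi
      have h2 : Subsingleton (oldExt (ModuleCat.of (BGS K m n) (BGS K m n ⧸ idealQ K m n))
          (ModuleCat.of (BGS K m n) M) i) := by
        rw [oldExt_subsingleton_iff]
        refine subsingleton_of_forall_eq 0 fun α => ?_
        rw [← Abelian.Ext.comp_mk₀_id α, hz.eq_of_src (𝟙 _) 0, Abelian.Ext.mk₀_zero,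
          Abelian.Ext.comp_zero]
      exact not_nontrivial_iff_subsingleton.2 h2 hi
    unfold extGrade
    rw [he, Nat.sInf_empty]
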